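/- Let m ≥ 1 be an integer and κ, p ∈ ℝ. Then for all α ∈ ℝ and all ζ in the unit disk 𝔻, 𝒫_m(∂)φ_α = A_m(α)φ_α + B_m(α)φ_{α−1} + C(α)φ_{α−2}, where A_m(α) = −(κ/2)α² + α + p/m, B_m(α) = (κ/2)α(2α−1) − 3α + (1 − 1/m)p, C(α) = −(κ/2)α(α−1) + 2α − p, and A_m(α) + B_m(α) + C(α) = 0. Moreover, for κ > 0 the unique pair (α, p) with α ≠ 0 satisfying A_m(α) = 0 and C(α) = 0 is α = (2m+4+κ)/((m+1)κ), p = m(2m+4+κ)(2+κ)/(2(m+1)²κ); for these values 𝒫_m(∂)φ_α = 0 on 𝔻. -/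

import Mathlib

open Complex Metric

/-- `φ_α(ζ) = (1−ζ)^α` (principal branch). -/
noncomputable def phim (α : ℝ) : ℂ → ℂ := fun ζ => (1 - ζ) ^ (α : ℂ)

/-- The `m`-fold boundary operator `𝒫_m(∂)`:
`𝒫_m(∂)f = −(κ/2)(ζ d/dζ)² f + ((ζ+1)/(ζ−1)) ζ f' + (p/m)((m−1)/(1−ζ) − m/(1−ζ)² + 1) f`. -/
noncomputable def Pmbnd (m : ℕ) (κ p : ℝ) (f : ℂ → ℂ) : ℂ → ℂ :=
  fun ζ => -((κ : ℂ)/2) * (ζ * deriv (fun t => t * deriv f t) ζ)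
    + ((ζ + 1)/(ζ - 1)) * (ζ * deriv f ζ)
    + ((p : ℂ)/(m : ℂ)) * (((m : ℂ) - 1)/(1 - ζ) - (m : ℂ)/(1 - ζ)^2 + 1) * f ζ

/-- `A_m(α) = −(κ/2)α² + α + p/m`. -/
noncomputable def Am (m : ℕ) (κ p α : ℝ) : ℝ := -(κ/2)*α^2 + α + p/(m : ℝ)

/-- `B_m(α) = (κ/2)α(2α−1) − 3α + (1 − 1/m)p`. -/
noncomputable def Bm (m : ℕ) (κ p α : ℝ) : ℝ := (κ/2)*α*(2*α - 1) - 3*α + (1 - 1/(m : ℝ))*p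

/-- `C(α) = −(κ/2)α(α−1) + 2α − p`. -/
noncomputable def Cm (κ p α : ℝ) : ℝ := -(κ/2)*α*(α - 1) + 2*α - p

theorem one_sub_mem_slitPlane {z : ℂ} (hz : z ∈ ball (0 : ℂ) 1) : 1 - z ∈ slitPlane := by
  refine Or.inl ?_
  have h := (re_le_norm z).trans_lt (mem_ball_zero_iff.1 hz)
  simpa using h

theorem phim_sub_one (α : ℝ) {z : ℂ} (hz : z ∈ ball (0 : ℂ) 1) :
    phim (α - 1) z = phim α z / (1 - z) := by
  simp [phim, cpow_sub _ _ (slitPlane_ne_zero (one_sub_mem_slitPlane hz))]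

theorem phim_sub_two (α : ℝ) {z : ℂ} (hz : z ∈ ball (0 : ℂ) 1) :
    phim (α - 2) z = phim α z / (1 - z) ^ 2 := by
  rw [show α - 2 = α - 1 - 1 by ring, phim_sub_one _ hz, phim_sub_one _ hz, div_div, sq]

theorem hasDerivAt_phim (α : ℝ) {z : ℂ} (hz : z ∈ ball (0 : ℂ) 1) :
    HasDerivAt (phim α) (-α * phim (α - 1) z) z := by
  have h := ((hasDerivAt_id z).const_sub 1).cpow_const (c := (α : ℂ)) (one_sub_mem_slitPlane hz)
  refine h.congr_deriv ?_
  simp [phim]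

theorem deriv_mul_deriv_phim (α : ℝ) {z : ℂ} (hz : z ∈ ball (0 : ℂ) 1) :
    deriv (fun t => t * deriv (phim α) t) z =
      -α * phim (α - 1) z + z * (α * (α - 1) * phim (α - 2) z) := by
  have heq : (fun t => t * deriv (phim α) t) =ᶠ[nhds z]
      fun t => t * (-α * phim (α - 1) t) := by
    filter_upwards [isOpen_ball.mem_nhds hz] with t ht
    rw [(hasDerivAt_phim α ht).deriv]
  have hd : HasDerivAt (fun t => t * (-α * phim (α - 1) t)) _ z :=
    (hasDerivAt_id z).mul ((hasDerivAt_phim (α - 1) hz).const_mul (-α : ℂ))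
  rw [heq.deriv_eq, hd.deriv, show α - 1 - 1 = α - 2 by ring]
  push_cast
  simp only [id]
  ring

theorem Pmbnd_phim {m : ℕ} (hm : 1 ≤ m) (κ p α : ℝ) {z : ℂ} (hz : z ∈ ball (0 : ℂ) 1) :
    Pmbnd m κ p (phim α) z =
      (Am m κ p α : ℂ) * phim α z + (Bm m κ p α : ℂ) * phim (α - 1) z
        + (Cm κ p α : ℂ) * phim (α - 2) z := by
  have hw : 1 - z ≠ 0 := slitPlane_ne_zero (one_sub_mem_slitPlane hz)
  have hm' : (m : ℂ) ≠ 0 := by exact_mod_cast (by lia : m ≠ 0)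
  have hw' : z - 1 = -(1 - z) := by ring
  rw [Pmbnd, deriv_mul_deriv_phim α hz, (hasDerivAt_phim α hz).deriv, phim_sub_two α hz,
    phim_sub_one α hz, Am, Bm, Cm, hw']
  push_cast
  field_simp
  ring

theorem Am_add_Bm_add_Cm (m : ℕ) (κ p α : ℝ) : Am m κ p α + Bm m κ p α + Cm κ p α = 0 := by
  rw [Am, Bm, Cm]
  ring

theorem Am_Cm_eq_zero_iff {m : ℕ} (hm : 1 ≤ m) {κ : ℝ} (hκ : 0 < κ) {p α : ℝ} (hα : α ≠ 0) :
    Am m κ p α = 0 ∧ Cm κ p α = 0 ↔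
      α = (2*(m:ℝ) + 4 + κ)/(((m:ℝ) + 1)*κ) ∧
        p = (m:ℝ)*(2*(m:ℝ) + 4 + κ)*(2 + κ)/(2*((m:ℝ) + 1)^2*κ) := by
  have hm0 : (m : ℝ) ≠ 0 := by exact_mod_cast (by lia : m ≠ 0)
  have hm1 : (m : ℝ) + 1 ≠ 0 := by positivity
  constructor
  · rintro ⟨hA, hC⟩
    have hp : p = -(κ/2)*α*(α - 1) + 2*α := by
      rw [Cm] at hC
      linarith
    have hαeq : α = (2*(m:ℝ) + 4 + κ)/(((m:ℝ) + 1)*κ) := by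
      rw [Am, hp] at hA
      field_simp at hA
      rw [mul_zero, mul_eq_zero, or_iff_right hα] at hA
      field_simp
      linarith
    refine ⟨hαeq, ?_⟩
    rw [hp, hαeq]
    field_simp
    ring
  · rintro ⟨rfl, rfl⟩
    rw [Am, Cm]
    constructor <;> field_simp <;> ring

/-- `𝒫_m(∂)φ_α = A_m(α)φ_α + B_m(α)φ_{α−1} + C(α)φ_{α−2}` on `𝔻`, with
`A_m + B_m + C = 0`; for `κ > 0` the unique pair `(α,p)` with `α ≠ 0`, `A_m(α) = 0` and
`C(α) = 0` is `α = (2m+4+κ)/((m+1)κ)`, `p = m(2m+4+κ)(2+κ)/(2(m+1)²κ)`, and for these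
values `𝒫_m(∂)φ_α = 0` on `𝔻`. -/
theorem stmt6 (m : ℕ) (hm : 1 ≤ m) (κ p : ℝ) :
    (∀ α : ℝ, ∀ ζ ∈ ball (0:ℂ) 1,
      Pmbnd m κ p (phim α) ζ =
        (Am m κ p α : ℂ) * phim α ζ + (Bm m κ p α : ℂ) * phim (α - 1) ζ
          + (Cm κ p α : ℂ) * phim (α - 2) ζ) ∧
    (∀ α : ℝ, Am m κ p α + Bm m κ p α + Cm κ p α = 0) ∧
    (0 < κ →
      (∀ α' p' : ℝ, α' ≠ 0 →
        (Am m κ p' α' = 0 ∧ Cm κ p' α' = 0 ↔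
          α' = (2*(m:ℝ) + 4 + κ)/(((m:ℝ) + 1)*κ) ∧
            p' = (m:ℝ)*(2*(m:ℝ) + 4 + κ)*(2 + κ)/(2*((m:ℝ) + 1)^2*κ))) ∧
      (∀ ζ ∈ ball (0:ℂ) 1,
        Pmbnd m κ ((m:ℝ)*(2*(m:ℝ) + 4 + κ)*(2 + κ)/(2*((m:ℝ) + 1)^2*κ))
          (phim ((2*(m:ℝ) + 4 + κ)/(((m:ℝ) + 1)*κ))) ζ = 0)) := by
  refine ⟨fun α ζ hζ => Pmbnd_phim hm κ p α hζ, Am_add_Bm_add_Cm m κ p, fun hκ =>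
    ⟨fun α' p' hα => Am_Cm_eq_zero_iff hm hκ hα, fun ζ hζ => ?_⟩⟩
  obtain ⟨hA, hC⟩ := (Am_Cm_eq_zero_iff hm hκ (by positivity)).2 ⟨rfl, rfl⟩
  have hB := Am_add_Bm_add_Cm m κ
    ((m:ℝ)*(2*(m:ℝ) + 4 + κ)*(2 + κ)/(2*((m:ℝ) + 1)^2*κ))
    ((2*(m:ℝ) + 4 + κ)/(((m:ℝ) + 1)*κ))
  rw [hA, hC, zero_add, add_zero] at hB
  rw [Pmbnd_phim hm _ _ _ hζ, hA, hB, hC]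
  simp
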